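/- For all integers n, m, M, R ≥ 1, every nonempty U ∈ ℱ_{0,n−1} and nonempty V ∈ ℱ_{0,m−1} with U ∩ V = ∅, and every integer r with 0 ≤ r < min(n,m), the total variation distance between the law of Σ_{U,V} (under P) and the geometric distribution Geo(P(V)/(P(V)+P(U))) is at most 2·[(1−P(V))^{M+1} + P(U) + 6MR(P(U)+P(V))² + 6M·φ(R − max(n,m)) + 8MR(P(U)+P(V))·(P(T^rU) + P(T^rV) + φ(κ_{U,V} + r − max(n,m)))]. -/

import Mathlib

open MeasureTheory Filter Set

/-- Total variation distance `d_TV(μ,ν) = sup_G |μ(G) − ν(G)|`. -/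
noncomputable def dTV {α : Type*} [MeasurableSpace α] (μ ν : Measure α) : ℝ :=
  sSup {x | ∃ s : Set α, MeasurableSet s ∧ x = |(μ s).toReal - (ν s).toReal|}

/-- Geometric distribution on ℕ with `Geo(ρ){k} = ρ(1−ρ)^k`. -/
noncomputable def geoMeasure (ρ : ℝ) : Measure ℕ :=
  Measure.sum fun k => ENNReal.ofReal (ρ * (1 - ρ) ^ k) • Measure.dirac k

/-- First hitting time `τ_V(ω) = min{k ≥ 1 : T^k ω ∈ V}` (junk value 0 if no such k). -/
noncomputable def hitTime {Ω : Type*} (T : Ω → Ω) (V : Set Ω) (ω : Ω) : ℕ :=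
  sInf {k | 1 ≤ k ∧ T^[k] ω ∈ V}

/-- `Σ_{U,V} = Σ_{k=0}^{τ_V−1} 1_U ∘ T^k`. -/
noncomputable def numVisits {Ω : Type*} (T : Ω → Ω) (U V : Set Ω) (ω : Ω) : ℕ :=
  ∑ k ∈ Finset.range (hitTime T V ω), U.indicator (fun _ => 1) (T^[k] ω)

/-- The φ-dependence coefficient between two sub-σ-algebras. -/
noncomputable def phiCoef {Ω : Type*} [MeasurableSpace Ω] (P : Measure Ω)
    (G H : MeasurableSpace Ω) : ℝ :=
  sSup {x | ∃ Γ Δ : Set Ω, MeasurableSet[G] Γ ∧ MeasurableSet[H] Δ ∧ P Γ ≠ 0 ∧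
    x = |(P (Γ ∩ Δ)).toReal / (P Γ).toReal - (P Δ).toReal|}

/-- σ-algebra on the sequence space generated by the coordinates in `s`. -/
noncomputable def coordAlg (𝓐 : Type*) [m𝓐 : MeasurableSpace 𝓐] (s : Set ℕ) :
    MeasurableSpace (ℕ → 𝓐) :=
  ⨆ i ∈ s, m𝓐.comap fun ω => ω i

/-- `φ(n) = sup_{m≥0} φ(ℱ_{0,m}, ℱ_{m+n,∞})`. -/
noncomputable def phiMix (𝓐 : Type*) [MeasurableSpace 𝓐] (P : Measure (ℕ → 𝓐)) (n : ℕ) : ℝ :=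
  ⨆ m : ℕ, phiCoef P (coordAlg 𝓐 (Set.Iic m)) (coordAlg 𝓐 (Set.Ici (m + n)))

/-- `φ` extended to ℤ by `φ(k) = 1` for `k ≤ 0`. -/
noncomputable def phiMixZ (𝓐 : Type*) [MeasurableSpace 𝓐] (P : Measure (ℕ → 𝓐)) (j : ℤ) : ℝ :=
  if j ≤ 0 then 1 else phiMix 𝓐 P j.toNat

/-- The left shift on `𝓐^ℕ`. -/
def shift (𝓐 : Type*) : (ℕ → 𝓐) → (ℕ → 𝓐) := fun ω n => ω (n + 1)

/-- `π(U) = min{1 ≤ k ≤ n : U ∩ T^{−k}U ≠ ∅}`. -/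
noncomputable def piRet {Ω : Type*} (T : Ω → Ω) (n : ℕ) (U : Set Ω) : ℕ :=
  sInf {k | 1 ≤ k ∧ k ≤ n ∧ (U ∩ T^[k] ⁻¹' U).Nonempty}

/-- `π(U,V) = min{0 ≤ k ≤ min(n,m) : U ∩ T^{−k}V ≠ ∅ or V ∩ T^{−k}U ≠ ∅}`. -/
noncomputable def piJoint {Ω : Type*} (T : Ω → Ω) (n m : ℕ) (U V : Set Ω) : ℕ :=
  sInf {k | k ≤ min n m ∧ ((U ∩ T^[k] ⁻¹' V).Nonempty ∨ (V ∩ T^[k] ⁻¹' U).Nonempty)}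

/-- `κ_{U,V} = min(π(U,V), π(U), π(V))`. -/
noncomputable def kappa {Ω : Type*} (T : Ω → Ω) (n m : ℕ) (U V : Set Ω) : ℕ :=
  min (piJoint T n m U V) (min (piRet T n U) (piRet T m V))

section helpers

variable {𝓐 : Type*} [m𝓐 : MeasurableSpace 𝓐]

lemma shift_iter (k : ℕ) (ω : ℕ → 𝓐) (i : ℕ) : (shift 𝓐)^[k] ω i = ω (i + k) := by
  induction k generalizing ω i with
  | zero => rfl
  | succ k ih =>
    rw [Function.iterate_succ_apply, ih]
    simp only [shift]
    congr 1

lemma coordAlg_mono {s t : Set ℕ} (h : s ⊆ t) : coordAlg 𝓐 s ≤ coordAlg 𝓐 t := by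
  unfold coordAlg
  exact biSup_mono h

lemma coordAlg_univ : coordAlg 𝓐 Set.univ = (MeasurableSpace.pi : MeasurableSpace (ℕ → 𝓐)) := by
  unfold coordAlg MeasurableSpace.pi
  simp

lemma coordAlg_le (s : Set ℕ) : coordAlg 𝓐 s ≤ (MeasurableSpace.pi : MeasurableSpace (ℕ → 𝓐)) := by
  rw [← coordAlg_univ]
  exact coordAlg_mono (Set.subset_univ _)

lemma shift_iter_pre {s t : Set ℕ} (k : ℕ) (h : ∀ i ∈ s, i + k ∈ t) {B : Set (ℕ → 𝓐)}
    (hB : MeasurableSet[coordAlg 𝓐 s] B) :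
    MeasurableSet[coordAlg 𝓐 t] ((shift 𝓐)^[k] ⁻¹' B) := by
  have : (coordAlg 𝓐 s).comap ((shift 𝓐)^[k]) ≤ coordAlg 𝓐 t := by
    conv_lhs => unfold coordAlg
    simp only [MeasurableSpace.comap_iSup, MeasurableSpace.comap_comp]
    refine iSup₂_le fun i hi => ?_
    have e : ((fun ω : ℕ → 𝓐 => ω i) ∘ (shift 𝓐)^[k]) = fun ω => ω (i + k) := by
      funext ω
      exact shift_iter k ω i
    rw [e]
    unfold coordAlg
    exact le_iSup₂_of_le (i + k) (h i hi) le_rfl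
  exact this _ ⟨B, hB, rfl⟩

lemma shift_iter_pre_Ici (k : ℕ) {B : Set (ℕ → 𝓐)} (hB : MeasurableSet B) :
    MeasurableSet[coordAlg 𝓐 (Set.Ici k)] ((shift 𝓐)^[k] ⁻¹' B) := by
  apply shift_iter_pre (s := Set.univ) k (fun i _ => by simp)
  rw [coordAlg_univ]
  exact hB

lemma shift_iter_image_meas [DiscreteMeasurableSpace 𝓐] [Countable 𝓐] (r : ℕ) {B : Set (ℕ → 𝓐)}
    (hB : MeasurableSet B) : MeasurableSet ((shift 𝓐)^[r] '' B) := by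
  have e : (shift 𝓐)^[r] '' B = ⋃ c : Fin r → 𝓐,
      (fun (ω : ℕ → 𝓐) (i : ℕ) => if h : i < r then c ⟨i, h⟩ else ω (i - r)) ⁻¹' B := by
    ext ω
    simp only [Set.mem_image, Set.mem_iUnion, Set.mem_preimage]
    constructor
    · rintro ⟨x, hx, rfl⟩
      refine ⟨fun i => x i, ?_⟩
      convert hx using 1
      funext i
      split_ifs with h
      · rfl
      · rw [shift_iter]
        congr 1
        omega
    · rintro ⟨c, hc⟩
      refine ⟨_, hc, ?_⟩
      funext i
      rw [shift_iter]
      simp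
  rw [e]
  refine MeasurableSet.iUnion fun c => ?_
  refine measurableSet_preimage ?_ hB
  refine measurable_pi_iff.2 fun i => ?_
  by_cases h : i < r
  · simp [h]
  · simp only [h, dite_false]
    exact measurable_pi_apply _

variable (P : Measure (ℕ → 𝓐)) [IsProbabilityMeasure P]

lemma phi_le_one {Γ Δ : Set (ℕ → 𝓐)} :
    |(P (Γ ∩ Δ)).toReal / (P Γ).toReal - (P Δ).toReal| ≤ 1 := by
  have h1 : (P (Γ ∩ Δ)).toReal ≤ (P Γ).toReal := measureReal_mono Set.inter_subset_left
  have h2 : (P (Γ ∩ Δ)).toReal / (P Γ).toReal ≤ 1 := div_le_one_of_le₀ h1 ENNReal.toReal_nonneg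
  have h3 : 0 ≤ (P (Γ ∩ Δ)).toReal / (P Γ).toReal := by positivity
  have h4 : (P Δ).toReal ≤ 1 := measureReal_le_one
  have h5 : 0 ≤ (P Δ).toReal := ENNReal.toReal_nonneg
  rw [abs_le]
  constructor <;> linarith

lemma phiMixZ_nonneg (j : ℤ) : 0 ≤ phiMixZ 𝓐 P j := by
  unfold phiMixZ
  split_ifs
  · norm_num
  · unfold phiMix phiCoef
    refine Real.iSup_nonneg fun m => Real.sSup_nonneg ?_
    rintro x ⟨Γ, Δ, -, -, -, rfl⟩
    exact abs_nonneg _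

lemma mix {Γ Δ : Set (ℕ → 𝓐)} {a b : ℕ} {j : ℤ} (hΓ : MeasurableSet[coordAlg 𝓐 (Set.Iic a)] Γ)
    (hΔ : MeasurableSet[coordAlg 𝓐 (Set.Ici b)] Δ) (hj : j + a ≤ b) :
    |P.real (Γ ∩ Δ) - P.real Γ * P.real Δ| ≤ phiMixZ 𝓐 P j * P.real Γ := by
  by_cases h0 : P Γ = 0
  · have h1 : P.real Γ = 0 := by simp [measureReal_def, h0]
    have h2 : P.real (Γ ∩ Δ) = 0 := by
      simp [measureReal_def, measure_mono_null Set.inter_subset_left h0]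
    simp [h1, h2]
  have hpos : 0 < P.real Γ := by
    rw [measureReal_def]
    exact ENNReal.toReal_pos h0 (measure_ne_top _ _)
  have hq : |P.real (Γ ∩ Δ) / P.real Γ - P.real Δ| ≤ phiMixZ 𝓐 P j := by
    unfold phiMixZ
    split_ifs with hj0
    · exact phi_le_one P
    · unfold phiMix
      have hb : ∀ m, BddAbove {x | ∃ Γ' Δ' : Set (ℕ → 𝓐),
          MeasurableSet[coordAlg 𝓐 (Set.Iic m)] Γ' ∧
          MeasurableSet[coordAlg 𝓐 (Set.Ici (m + j.toNat))] Δ' ∧ P Γ' ≠ 0 ∧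
          x = |(P (Γ' ∩ Δ')).toReal / (P Γ').toReal - (P Δ').toReal|} := by
        intro m
        refine ⟨1, ?_⟩
        rintro x ⟨_, _, -, -, -, rfl⟩
        exact phi_le_one P
      refine le_ciSup_of_le ?_ a ?_
      · refine ⟨1, ?_⟩
        rintro x ⟨m, rfl⟩
        refine Real.sSup_le ?_ zero_le_one
        rintro x ⟨_, _, -, -, -, rfl⟩
        exact phi_le_one P
      · refine le_csSup (hb a) ⟨Γ, Δ, hΓ, ?_, h0, rfl⟩
        refine coordAlg_mono ?_ _ hΔ
        intro i hi
        simp only [Set.mem_Ici] at *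
        omega
  have : P.real (Γ ∩ Δ) - P.real Γ * P.real Δ
      = (P.real (Γ ∩ Δ) / P.real Γ - P.real Δ) * P.real Γ := by
    field_simp
  rw [this, abs_mul, abs_of_pos hpos]
  exact mul_le_mul_of_nonneg_right hq hpos.le

lemma pair_bound [DiscreteMeasurableSpace 𝓐] [Countable 𝓐]
    (hinv : MeasurePreserving (shift 𝓐) P P) {Z Q : Set (ℕ → 𝓐)} {N κ L r : ℕ}
    (hZ : MeasurableSet[coordAlg 𝓐 (Set.Iio N)] Z) (hQ : MeasurableSet Q) (hN : N ≤ L)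
    (hκ : ∀ j, 1 ≤ j → j < κ → Z ∩ (shift 𝓐)^[j] ⁻¹' Q = ∅) (j : ℕ) (hj : 1 ≤ j) :
    P.real (Z ∩ (shift 𝓐)^[j] ⁻¹' Q) ≤
      P.real Z * (P.real ((shift 𝓐)^[r] '' Q) + phiMixZ 𝓐 P ((κ : ℤ) + r - L)) := by
  by_cases hjk : j < κ
  · rw [hκ j hj hjk]
    have := phiMixZ_nonneg P ((κ : ℤ) + r - L)
    rw [measureReal_empty]
    exact mul_nonneg measureReal_nonneg (add_nonneg measureReal_nonneg this)
  push Not at hjk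
  have hI := shift_iter_image_meas r hQ
  have hsub : Z ∩ (shift 𝓐)^[j] ⁻¹' Q ⊆
      Z ∩ (shift 𝓐)^[r + j] ⁻¹' ((shift 𝓐)^[r] '' Q) := by
    rintro ω ⟨h1, h2⟩
    refine ⟨h1, ?_⟩
    rw [Set.mem_preimage, Function.iterate_add_apply]
    exact ⟨_, h2, rfl⟩
  have h1 := measureReal_mono (μ := P) hsub
  have hZ' : MeasurableSet[coordAlg 𝓐 (Set.Iic N)] Z :=
    coordAlg_mono Set.Iio_subset_Iic_self _ hZ
  have h2 := mix P (j := (κ : ℤ) + r - L) hZ' (shift_iter_pre_Ici (r + j) hI)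
    (by push_cast; omega)
  have h3 : P.real ((shift 𝓐)^[r + j] ⁻¹' ((shift 𝓐)^[r] '' Q)) =
      P.real ((shift 𝓐)^[r] '' Q) :=
    (hinv.iterate (r + j)).measureReal_preimage hI.nullMeasurableSet
  rw [h3] at h2
  have h4 := (abs_le.1 h2).2
  linarith

lemma gen_meas_sum {Ω : Type*} [MeasurableSpace Ω] (T : Ω → Ω) (U : Set Ω) (a : ℕ)
    (h : ∀ i < a, MeasurableSet (T^[i] ⁻¹' U)) :
    Measurable (fun ω => ∑ k ∈ Finset.range a, U.indicator (fun _ => 1) (T^[k] ω) : Ω → ℕ) := by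
  refine Finset.measurable_sum _ fun i hi => ?_
  have e : (fun ω => U.indicator (fun _ => 1) (T^[i] ω) : Ω → ℕ) =
      (T^[i] ⁻¹' U).indicator (fun _ => 1) := by
    funext ω
    rfl
  rw [e]
  exact measurable_const.indicator (h i (Finset.mem_range.1 hi))

def visA {Ω : Type*} (T : Ω → Ω) (V : Set Ω) (a : ℕ) : Set Ω :=
  {ω | ∀ i, 1 ≤ i → i < a → T^[i] ω ∉ V}

noncomputable def visS {Ω : Type*} (T : Ω → Ω) (U : Set Ω) (a : ℕ) (ω : Ω) : ℕ :=
  ∑ k ∈ Finset.range a, U.indicator (fun _ => 1) (T^[k] ω)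

noncomputable def visX {Ω : Type*} (T : Ω → Ω) (U V : Set Ω) (f : ℕ → ℝ) (a : ℕ) (ω : Ω) : ℝ :=
  (visA T V a).indicator (fun ω => f (visS T U a ω)) ω

lemma visS_le {Ω : Type*} (T : Ω → Ω) (U : Set Ω) (a : ℕ) (ω : Ω) : visS T U a ω ≤ a := by
  unfold visS
  calc _ ≤ ∑ k ∈ Finset.range a, 1 := by
        refine Finset.sum_le_sum fun i _ => ?_
        by_cases h : T^[i] ω ∈ U <;> simp [h]
    _ = a := by simp

lemma gen_meas_A {Ω : Type*} [MeasurableSpace Ω] (T : Ω → Ω) (V : Set Ω) (a : ℕ)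
    (h : ∀ i < a, MeasurableSet (T^[i] ⁻¹' V)) : MeasurableSet (visA T V a) := by
  have e : visA T V a = ⋂ i, ⋂ (_ : 1 ≤ i), ⋂ (_ : i < a), (T^[i] ⁻¹' V)ᶜ := by
    ext ω
    simp [visA]
  rw [e]
  exact MeasurableSet.iInter fun i => MeasurableSet.iInter fun _ => MeasurableSet.iInter fun hi =>
    (h i hi).compl

lemma gen_meas_AS {Ω : Type*} [MeasurableSpace Ω] (T : Ω → Ω) (U V : Set Ω) (a s : ℕ)
    (hU : ∀ i < a, MeasurableSet (T^[i] ⁻¹' U)) (hV : ∀ i < a, MeasurableSet (T^[i] ⁻¹' V)) :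
    MeasurableSet (visA T V a ∩ visS T U a ⁻¹' {s}) :=
  (gen_meas_A T V a hV).inter ((gen_meas_sum T U a hU) (measurableSet_singleton s))

lemma gen_meas_X {Ω : Type*} [MeasurableSpace Ω] {T : Ω → Ω} (hT : Measurable T) {U V : Set Ω}
    (hU : MeasurableSet U) (hV : MeasurableSet V) (f : ℕ → ℝ) (a : ℕ) :
    Measurable (visX T U V f a) := by
  have hS : Measurable (visS T U a) :=
    gen_meas_sum T U a fun i _ => hT.iterate i hU
  have : Measurable (fun ω => f (visS T U a ω)) := (measurable_of_countable f).comp hS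
  exact this.indicator (gen_meas_A T V a fun i _ => hT.iterate i hV)

lemma visX_abs {Ω : Type*} (T : Ω → Ω) (U V : Set Ω) (f : ℕ → ℝ) (hf : ∀ s, |f s| ≤ 1) (a : ℕ)
    (ω : Ω) : |visX T U V f a ω| ≤ 1 := by
  unfold visX
  by_cases h : ω ∈ visA T V a
  · simpa [h] using hf _
  · simp [h]

/-- States at times `b ≤ a` agree when no visit occurs in between. -/
lemma visX_eq {Ω : Type*} (T : Ω → Ω) (U V : Set Ω) (f : ℕ → ℝ) {a b : ℕ} (hab : b ≤ a) (ω : Ω)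
    (h : ∀ i, b ≤ i → i < a → T^[i] ω ∉ U ∪ V) : visX T U V f a ω = visX T U V f b ω := by
  have hS : visS T U a ω = visS T U b ω := by
    unfold visS
    symm
    refine Finset.sum_subset (Finset.range_mono hab) fun i hi hib => ?_
    simp only [Finset.mem_range, not_lt] at hi hib
    have := h i hib hi
    simp only [Set.mem_union, not_or] at this
    simp [this.1]
  have hA : ω ∈ visA T V a ↔ ω ∈ visA T V b := by
    constructor
    · intro hh i h1 h2
      exact hh i h1 (h2.trans_le hab)
    · intro hh i h1 h2
      by_cases hib : i < b
      · exact hh i h1 hib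
      · exact fun hv => h i (not_lt.1 hib) h2 (Or.inr hv)
  unfold visX
  by_cases hh : ω ∈ visA T V a
  · rw [Set.indicator_of_mem hh, Set.indicator_of_mem (hA.1 hh), hS]
  · rw [Set.indicator_of_notMem hh, Set.indicator_of_notMem (fun h' => hh (hA.2 h'))]

/-- `visX` as a finite sum of indicators. -/
lemma visX_sum {Ω : Type*} (T : Ω → Ω) (U V : Set Ω) (f : ℕ → ℝ) (a : ℕ) :
    visX T U V f a = fun ω => ∑ s ∈ Finset.range (a + 1),
      (visA T V a ∩ visS T U a ⁻¹' {s}).indicator (fun _ => f s) ω := by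
  funext ω
  rw [Finset.sum_eq_single (visS T U a ω)]
  · unfold visX
    by_cases h : ω ∈ visA T V a <;> simp [h, Set.indicator]
  · intro s _ hs
    rw [Set.indicator_of_notMem]
    rintro ⟨_, h2⟩
    exact hs h2.symm
  · intro h
    exact absurd (Finset.mem_range.2 (Nat.lt_succ_of_le (visS_le T U a ω))) h

lemma decouple (hinv : MeasurePreserving (shift 𝓐) P P) {U V Q : Set (ℕ → 𝓐)} {L : ℕ}
    (hU : MeasurableSet[coordAlg 𝓐 (Set.Iio L)] U) (hV : MeasurableSet[coordAlg 𝓐 (Set.Iio L)] V)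
    (hQ : MeasurableSet Q) (f : ℕ → ℝ) (hf : ∀ s, |f s| ≤ 1) (R a : ℕ) :
    |∫ ω in (shift 𝓐)^[a] ⁻¹' Q, visX (shift 𝓐) U V f (a - R) ω ∂P
      - P.real Q * ∫ ω, visX (shift 𝓐) U V f (a - R) ω ∂P| ≤ phiMixZ 𝓐 P ((R : ℤ) - L) := by
  set b := a - R with hb
  set E : ℕ → Set (ℕ → 𝓐) := fun s => visA (shift 𝓐) V b ∩ visS (shift 𝓐) U b ⁻¹' {s} with hE
  set D := (shift 𝓐)^[a] ⁻¹' Q with hD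
  have hPD : P.real D = P.real Q := (hinv.iterate a).measureReal_preimage hQ.nullMeasurableSet
  by_cases hb0 : b = 0
  · have hX : ∀ ω, visX (shift 𝓐) U V f b ω = f 0 := by
      intro ω
      rw [hb0]
      simp [visX, visA, visS]
    simp only [hX]
    rw [setIntegral_const, integral_const, hPD]
    simp only [probReal_univ, smul_eq_mul, one_mul, sub_self, abs_zero]
    exact phiMixZ_nonneg P _
  have hEm : ∀ s, MeasurableSet[coordAlg 𝓐 (Set.Iic (b + L))] (E s) := by
    intro s
    refine @gen_meas_AS _ (coordAlg 𝓐 (Set.Iic (b + L))) (shift 𝓐) U V b s ?_ ?_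
    · intro i hi
      refine shift_iter_pre i (fun k hk => ?_) hU
      simp only [Set.mem_Iio, Set.mem_Iic] at *
      omega
    · intro i hi
      refine shift_iter_pre i (fun k hk => ?_) hV
      simp only [Set.mem_Iio, Set.mem_Iic] at *
      omega
  have hEm' : ∀ s, MeasurableSet (E s) := fun s => coordAlg_le _ _ (hEm s)
  have hint : ∀ (μ : Measure (ℕ → 𝓐)) [IsFiniteMeasure μ],
      ∫ ω, visX (shift 𝓐) U V f b ω ∂μ = ∑ s ∈ Finset.range (b + 1), μ.real (E s) * f s := by
    intro μ _
    rw [visX_sum, integral_finsetSum]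
    · refine Finset.sum_congr rfl fun s _ => ?_
      rw [integral_indicator_const _ (hEm' s), smul_eq_mul]
    · intro s _
      exact (integrable_const _).indicator (hEm' s)
  rw [hint P, hint (P.restrict D), Finset.mul_sum, ← Finset.sum_sub_distrib]
  have hterm : ∀ s ∈ Finset.range (b + 1),
      |(P.restrict D).real (E s) * f s - P.real Q * (P.real (E s) * f s)| ≤
        phiMixZ 𝓐 P ((R : ℤ) - L) * P.real (E s) := by
    intro s _
    have h1 := mix P (j := (R : ℤ) - L) (hEm s) (shift_iter_pre_Ici a hQ) (by push_cast; omega)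
    rw [measureReal_restrict_apply (hEm' s)]
    have : P.real (E s ∩ D) * f s - P.real Q * (P.real (E s) * f s)
        = (P.real (E s ∩ D) - P.real (E s) * P.real D) * f s := by rw [hPD]; ring
    rw [this, abs_mul]
    calc _ ≤ |P.real (E s ∩ D) - P.real (E s) * P.real D| * 1 :=
          mul_le_mul_of_nonneg_left (hf s) (abs_nonneg _)
      _ ≤ _ := by rw [mul_one]; exact h1
  have hsum : ∑ s ∈ Finset.range (b + 1), P.real (E s) ≤ 1 := by
    rw [← measureReal_biUnion_finset (μ := P) (s := Finset.range (b + 1)) (f := E)]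
    · exact measureReal_le_one
    · intro s _ t _ hst
      refine Set.disjoint_left.2 ?_
      rintro ω ⟨_, h1⟩ ⟨_, h2⟩
      exact hst (h1.symm.trans h2)
    · intro s _
      exact hEm' s
  calc _ ≤ ∑ s ∈ Finset.range (b + 1), phiMixZ 𝓐 P ((R : ℤ) - L) * P.real (E s) :=
        (Finset.abs_sum_le_sum_abs _ _).trans (Finset.sum_le_sum hterm)
    _ = phiMixZ 𝓐 P ((R : ℤ) - L) * ∑ s ∈ Finset.range (b + 1), P.real (E s) := by
        rw [Finset.mul_sum]
    _ ≤ phiMixZ 𝓐 P ((R : ℤ) - L) * 1 :=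
        mul_le_mul_of_nonneg_left hsum (phiMixZ_nonneg P _)
    _ = _ := mul_one _

lemma key (hinv : MeasurePreserving (shift 𝓐) P P) {U V Q : Set (ℕ → 𝓐)} {L : ℕ}
    (hU : MeasurableSet[coordAlg 𝓐 (Set.Iio L)] U) (hV : MeasurableSet[coordAlg 𝓐 (Set.Iio L)] V)
    (hQ : MeasurableSet Q) (f : ℕ → ℝ) (hf : ∀ s, |f s| ≤ 1) (R a : ℕ) (c : ℝ)
    (hc0 : 0 ≤ c)
    (hc : ∀ j, 1 ≤ j → P.real ((U ∪ V) ∩ (shift 𝓐)^[j] ⁻¹' Q) ≤ c) :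
    |∫ ω in (shift 𝓐)^[a] ⁻¹' Q, visX (shift 𝓐) U V f a ω ∂P
      - P.real Q * ∫ ω, visX (shift 𝓐) U V f a ω ∂P| ≤
      2 * R * c + 2 * R * P.real (U ∪ V) * P.real Q + phiMixZ 𝓐 P ((R : ℤ) - L) := by
  have hU' : MeasurableSet U := coordAlg_le _ _ hU
  have hV' : MeasurableSet V := coordAlg_le _ _ hV
  have hT := hinv.measurable
  set b := a - R with hb
  set D := (shift 𝓐)^[a] ⁻¹' Q with hD
  have hDm : MeasurableSet D := hT.iterate a hQ
  set I := Finset.Ico b a with hI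
  set B : Set (ℕ → 𝓐) := ⋃ i ∈ I, (shift 𝓐)^[i] ⁻¹' (U ∪ V) with hB
  have hBm : MeasurableSet B :=
    Finset.measurableSet_biUnion _ fun i _ => hT.iterate i (hU'.union hV')
  have hcard : (I.card : ℝ) ≤ R := by
    rw [hI, Nat.card_Ico]
    exact_mod_cast (by omega : a - b ≤ R)
  have hi : ∀ (μ : Measure (ℕ → 𝓐)) [IsFiniteMeasure μ] (k : ℕ),
      Integrable (visX (shift 𝓐) U V f k) μ := by
    intro μ _ k
    refine Integrable.of_bound (gen_meas_X hT hU' hV' f k).aestronglyMeasurable 1 ?_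
    exact Eventually.of_forall fun ω => visX_abs _ U V f hf k ω
  have hdiff : ∀ ω, |visX (shift 𝓐) U V f a ω - visX (shift 𝓐) U V f b ω| ≤
      B.indicator (fun _ => (2 : ℝ)) ω := by
    intro ω
    by_cases h : ω ∈ B
    · rw [Set.indicator_of_mem h]
      have h1 := abs_le.1 (visX_abs (shift 𝓐) U V f hf a ω)
      have h2 := abs_le.1 (visX_abs (shift 𝓐) U V f hf b ω)
      rw [abs_le]
      constructor <;> linarith [h1.1, h1.2, h2.1, h2.2]
    · rw [Set.indicator_of_notMem h, visX_eq (shift 𝓐) U V f (Nat.sub_le a R) ω]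
      · simp [hb]
      · intro i h1 h2 h3
        exact h (Set.mem_biUnion (x := i) (by simp [hI, h2, hb, h1]) h3)
  have hbd : ∀ (μ : Measure (ℕ → 𝓐)) [IsFiniteMeasure μ],
      |∫ ω, visX (shift 𝓐) U V f a ω ∂μ - ∫ ω, visX (shift 𝓐) U V f b ω ∂μ| ≤
        2 * μ.real B := by
    intro μ _
    rw [← integral_sub (hi μ a) (hi μ b)]
    refine (abs_integral_le_integral_abs).trans ?_
    refine (integral_mono ((hi μ a).sub (hi μ b)).abs
      ((integrable_const (2 : ℝ)).indicator hBm) hdiff).trans ?_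
    rw [integral_indicator_const _ hBm, smul_eq_mul, mul_comm]
  have h1 := hbd (P.restrict D)
  have h2 := hbd P
  have h3 := decouple P hinv hU hV hQ f hf R a
  rw [← hb, ← hD] at h3
  have hB1 : (P.restrict D).real B ≤ R * c := by
    rw [measureReal_restrict_apply hBm]
    have e : B ∩ D = ⋃ i ∈ I, ((shift 𝓐)^[i] ⁻¹' (U ∪ V) ∩ D) := by
      rw [hB, Set.iUnion₂_inter]
    rw [e]
    refine (measureReal_biUnion_finset_le _ _).trans ?_
    have hle : ∀ i ∈ I, P.real ((shift 𝓐)^[i] ⁻¹' (U ∪ V) ∩ D) ≤ c := by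
      intro i hiI
      rw [hI, Finset.mem_Ico] at hiI
      have e2 : (shift 𝓐)^[i] ⁻¹' (U ∪ V) ∩ D =
          (shift 𝓐)^[i] ⁻¹' ((U ∪ V) ∩ (shift 𝓐)^[a - i] ⁻¹' Q) := by
        rw [Set.preimage_inter, ← Set.preimage_comp, ← Function.iterate_add,
          Nat.sub_add_cancel hiI.2.le]
      rw [e2, (hinv.iterate i).measureReal_preimage
        ((hU'.union hV').inter (hT.iterate (a - i) hQ)).nullMeasurableSet]
      exact hc _ (by omega)
    refine (Finset.sum_le_card_nsmul _ _ _ hle).trans ?_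
    rw [nsmul_eq_mul]
    exact mul_le_mul_of_nonneg_right hcard hc0
  have hB2 : P.real B ≤ R * P.real (U ∪ V) := by
    refine (measureReal_biUnion_finset_le _ _).trans ?_
    have hle : ∀ i ∈ I, P.real ((shift 𝓐)^[i] ⁻¹' (U ∪ V)) ≤ P.real (U ∪ V) := by
      intro i _
      rw [(hinv.iterate i).measureReal_preimage (hU'.union hV').nullMeasurableSet]
    refine (Finset.sum_le_card_nsmul _ _ _ hle).trans ?_
    rw [nsmul_eq_mul]
    exact mul_le_mul_of_nonneg_right hcard measureReal_nonneg
  have hq0 : 0 ≤ P.real Q := measureReal_nonneg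
  have h4 : |P.real Q * (∫ ω, visX (shift 𝓐) U V f a ω ∂P
      - ∫ ω, visX (shift 𝓐) U V f b ω ∂P)| ≤ P.real Q * (2 * (R * P.real (U ∪ V))) := by
    rw [abs_mul, abs_of_nonneg hq0]
    refine mul_le_mul_of_nonneg_left (h2.trans ?_) hq0
    linarith
  rw [abs_le] at *
  constructor <;> nlinarith [h1.1, h1.2, h3.1, h3.2, h4.1, h4.2]

noncomputable def geoG (q : ℝ) (G : Set ℕ) (s : ℕ) : ℝ :=
  ∑' j : ℕ, q * (1 - q) ^ j * G.indicator (fun _ => (1 : ℝ)) (s + j)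

lemma ind_bd (G : Set ℕ) (s : ℕ) : 0 ≤ G.indicator (fun _ => (1 : ℝ)) s ∧
    G.indicator (fun _ => (1 : ℝ)) s ≤ 1 := by
  by_cases h : s ∈ G <;> simp [h]

lemma geo_hasSum {q : ℝ} (h0 : 0 ≤ q) (h1 : q ≤ 1) :
    ∃ t : ℝ, t ≤ 1 ∧ HasSum (fun j : ℕ => q * (1 - q) ^ j) t := by
  rcases h0.eq_or_lt with h | h
  · refine ⟨0, zero_le_one, ?_⟩
    simp [← h, hasSum_zero]
  · refine ⟨1, le_rfl, ?_⟩
    have := (hasSum_geometric_of_lt_one (r := 1 - q) (by linarith) (by linarith)).mul_left q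
    rwa [sub_sub_cancel, mul_inv_cancel₀ h.ne'] at this

lemma geo_term_bd {q : ℝ} (h0 : 0 ≤ q) (h1 : q ≤ 1) (G : Set ℕ) (s j : ℕ) :
    0 ≤ q * (1 - q) ^ j * G.indicator (fun _ => (1 : ℝ)) (s + j) ∧
    q * (1 - q) ^ j * G.indicator (fun _ => (1 : ℝ)) (s + j) ≤ q * (1 - q) ^ j := by
  have h2 : 0 ≤ q * (1 - q) ^ j := mul_nonneg h0 (pow_nonneg (by linarith) _)
  have h3 := ind_bd G (s + j)
  exact ⟨mul_nonneg h2 h3.1, mul_le_of_le_one_right h2 h3.2⟩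

lemma geo_summable {q : ℝ} (h0 : 0 ≤ q) (h1 : q ≤ 1) (G : Set ℕ) (s : ℕ) :
    Summable (fun j : ℕ => q * (1 - q) ^ j * G.indicator (fun _ => (1 : ℝ)) (s + j)) := by
  obtain ⟨t, _, ht⟩ := geo_hasSum h0 h1
  exact Summable.of_nonneg_of_le (fun j => (geo_term_bd h0 h1 G s j).1)
    (fun j => (geo_term_bd h0 h1 G s j).2) ht.summable

lemma geoG_bd {q : ℝ} (h0 : 0 ≤ q) (h1 : q ≤ 1) (G : Set ℕ) (s : ℕ) :
    0 ≤ geoG q G s ∧ geoG q G s ≤ 1 := by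
  obtain ⟨t, ht1, ht⟩ := geo_hasSum h0 h1
  refine ⟨tsum_nonneg fun j => (geo_term_bd h0 h1 G s j).1, ?_⟩
  refine le_trans ?_ ht1
  rw [← ht.tsum_eq]
  exact (geo_summable h0 h1 G s).tsum_le_tsum (fun j => (geo_term_bd h0 h1 G s j).2) ht.summable

lemma geoG_rec {q : ℝ} (h0 : 0 ≤ q) (h1 : q ≤ 1) (G : Set ℕ) (s : ℕ) :
    geoG q G s = q * G.indicator (fun _ => (1 : ℝ)) s + (1 - q) * geoG q G (s + 1) := by
  unfold geoG
  rw [(geo_summable h0 h1 G s).tsum_eq_zero_add, ← tsum_mul_left]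
  congr 1
  · simp
  · refine tsum_congr fun j => ?_
    rw [show s + (j + 1) = s + 1 + j by ring]
    ring

lemma geoG_zero {q : ℝ} (h0 : 0 ≤ q) (h1 : q ≤ 1) (G : Set ℕ) :
    (geoMeasure q G).toReal = geoG q G 0 := by
  unfold geoMeasure geoG
  rw [Measure.sum_apply _ (MeasurableSet.of_discrete)]
  have e : ∀ k : ℕ, (ENNReal.ofReal (q * (1 - q) ^ k) • Measure.dirac k) G =
      ENNReal.ofReal (q * (1 - q) ^ k * G.indicator (fun _ => (1 : ℝ)) (0 + k)) := by
    intro k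
    by_cases h : k ∈ G <;> simp [h]
  simp only [e]
  rw [← ENNReal.ofReal_tsum_of_nonneg (fun j => (geo_term_bd h0 h1 G 0 j).1)
    (geo_summable h0 h1 G 0), ENNReal.toReal_ofReal]
  exact tsum_nonneg fun j => (geo_term_bd h0 h1 G 0 j).1

lemma hitTime_eq {Ω : Type*} (T : Ω → Ω) (V : Set Ω) (a : ℕ) (ha : 1 ≤ a) (ω : Ω)
    (hA : ω ∈ visA T V a) (hV : T^[a] ω ∈ V) : hitTime T V ω = a := by
  unfold hitTime
  refine le_antisymm (Nat.sInf_le ⟨ha, hV⟩) ?_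
  have hmem := Nat.sInf_mem (s := {k | 1 ≤ k ∧ T^[k] ω ∈ V}) ⟨a, ha, hV⟩
  by_contra hlt
  exact hA _ hmem.1 (not_le.1 hlt) hmem.2

lemma hitTime_meas {Ω : Type*} [MeasurableSpace Ω] {T : Ω → Ω} (hT : Measurable T) {V : Set Ω}
    (hV : MeasurableSet V) : Measurable (hitTime T V) := by
  have hmain : ∀ a, 1 ≤ a → hitTime T V ⁻¹' {a} = visA T V a ∩ T^[a] ⁻¹' V := by
    intro a ha
    ext ω
    constructor
    · intro h
      have h : hitTime T V ω = a := h
      have hne : {k | 1 ≤ k ∧ T^[k] ω ∈ V}.Nonempty := by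
        by_contra hn
        rw [Set.not_nonempty_iff_eq_empty] at hn
        unfold hitTime at h
        rw [hn, Nat.sInf_empty] at h
        omega
      have hmem := Nat.sInf_mem hne
      change 1 ≤ hitTime T V ω ∧ T^[hitTime T V ω] ω ∈ V at hmem
      rw [h] at hmem
      refine ⟨fun i h1 h2 h3 => ?_, hmem.2⟩
      have : hitTime T V ω ≤ i := Nat.sInf_le ⟨h1, h3⟩
      omega
    · rintro ⟨h1, h2⟩
      exact hitTime_eq T V a ha ω h1 h2
  have hm : ∀ a, 1 ≤ a → MeasurableSet (hitTime T V ⁻¹' {a}) := by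
    intro a ha
    rw [hmain a ha]
    exact (gen_meas_A T V a fun i _ => hT.iterate i hV).inter (hT.iterate a hV)
  refine measurable_to_countable' fun a => ?_
  rcases Nat.eq_zero_or_pos a with rfl | ha
  · have : hitTime T V ⁻¹' {0} = (⋃ a, ⋃ (_ : 1 ≤ a), hitTime T V ⁻¹' {a})ᶜ := by
      ext ω
      simp only [Set.mem_preimage, Set.mem_singleton_iff, Set.mem_compl_iff, Set.mem_iUnion]
      constructor
      · rintro h ⟨a, ha, h'⟩
        omega
      · intro h
        by_contra h0
        exact h ⟨_, Nat.one_le_iff_ne_zero.2 h0, rfl⟩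
    rw [this]
    exact (MeasurableSet.iUnion fun a => MeasurableSet.iUnion fun ha => hm a ha).compl
  · exact hm a ha

lemma numVisits_meas {Ω : Type*} [MeasurableSpace Ω] {T : Ω → Ω} (hT : Measurable T) {U V : Set Ω}
    (hU : MeasurableSet U) (hV : MeasurableSet V) : Measurable (numVisits T U V) := by
  refine measurable_to_countable' fun s => ?_
  have : numVisits T U V ⁻¹' {s} = ⋃ a, hitTime T V ⁻¹' {a} ∩ visS T U a ⁻¹' {s} := by
    ext ω
    simp [numVisits, visS]
  rw [this]
  exact MeasurableSet.iUnion fun a => (hitTime_meas hT hV (measurableSet_singleton a)).inter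
    (gen_meas_sum T U a (fun i _ => hT.iterate i hU) (measurableSet_singleton s))

/-- Interpolating function. -/
noncomputable def visD {Ω : Type*} (T : Ω → Ω) (U V : Set Ω) (g : ℕ → ℝ) (G : Set ℕ) (a : ℕ)
    (ω : Ω) : ℝ :=
  visX T U V g a ω +
    (visA T V a)ᶜ.indicator (fun ω => G.indicator (fun _ => (1 : ℝ)) (numVisits T U V ω)) ω

lemma visA_succ {Ω : Type*} (T : Ω → Ω) (V : Set Ω) (a : ℕ) (ha : 1 ≤ a) (ω : Ω) :
    ω ∈ visA T V (a + 1) ↔ ω ∈ visA T V a ∧ T^[a] ω ∉ V := by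
  constructor
  · intro h
    exact ⟨fun i h1 h2 => h i h1 (by omega), h a ha (by omega)⟩
  · rintro ⟨h1, h2⟩ i hi1 hi2
    rcases Nat.lt_succ_iff_lt_or_eq.1 hi2 with h | h
    · exact h1 i hi1 h
    · rw [h]
      exact h2

lemma visS_succ {Ω : Type*} (T : Ω → Ω) (U : Set Ω) (a : ℕ) (ω : Ω) :
    visS T U (a + 1) ω = visS T U a ω + U.indicator (fun _ => 1) (T^[a] ω) := by
  unfold visS
  rw [Finset.sum_range_succ]

lemma visD_step {Ω : Type*} (T : Ω → Ω) (U V : Set Ω) (hUV : U ∩ V = ∅) (g : ℕ → ℝ) (G : Set ℕ)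
    (a : ℕ) (ha : 1 ≤ a) (ω : Ω) :
    visD T U V g G (a + 1) ω - visD T U V g G a ω =
      (T^[a] ⁻¹' U).indicator (visX T U V (fun s => g (s + 1) - g s) a) ω +
      (T^[a] ⁻¹' V).indicator
        (visX T U V (fun s => G.indicator (fun _ => (1 : ℝ)) s - g s) a) ω := by
  have hs := visA_succ T V a ha ω
  by_cases hA : ω ∈ visA T V a
  · by_cases hV : T^[a] ω ∈ V
    · have hU : T^[a] ω ∉ U := fun hU => by
        have : T^[a] ω ∈ U ∩ V := ⟨hU, hV⟩
        rw [hUV] at this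
        exact this
      have hA1 : ω ∉ visA T V (a + 1) := fun h => (hs.1 h).2 hV
      have hN : numVisits T U V ω = visS T U a ω := by
        unfold numVisits visS
        rw [hitTime_eq T V a ha ω hA hV]
      have hV' : ω ∈ T^[a] ⁻¹' V := hV
      have hU' : ω ∉ T^[a] ⁻¹' U := hU
      rw [Set.indicator_of_mem hV', Set.indicator_of_notMem hU']
      simp only [visD, visX]
      rw [Set.indicator_of_notMem hA1, Set.indicator_of_mem (show ω ∈ (visA T V (a + 1))ᶜ from hA1),
        Set.indicator_of_mem hA, Set.indicator_of_notMem (show ω ∉ (visA T V a)ᶜ from not_not.2 hA),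
        Set.indicator_of_mem hA, hN]
      ring
    · have hA1 : ω ∈ visA T V (a + 1) := hs.2 ⟨hA, hV⟩
      have hV' : ω ∉ T^[a] ⁻¹' V := hV
      rw [Set.indicator_of_notMem hV']
      simp only [visD, visX]
      rw [Set.indicator_of_mem hA1, Set.indicator_of_notMem
        (show ω ∉ (visA T V (a + 1))ᶜ from not_not.2 hA1),
        Set.indicator_of_mem hA, Set.indicator_of_notMem (show ω ∉ (visA T V a)ᶜ from not_not.2 hA),
        visS_succ]
      by_cases hU : T^[a] ω ∈ U
      · rw [Set.indicator_of_mem (show ω ∈ T^[a] ⁻¹' U from hU)]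
        unfold visX
        rw [Set.indicator_of_mem hA, Set.indicator_of_mem hU]
        ring
      · rw [Set.indicator_of_notMem (show ω ∉ T^[a] ⁻¹' U from hU), Set.indicator_of_notMem hU]
        simp
  · have hA1 : ω ∉ visA T V (a + 1) := fun h => hA (hs.1 h).1
    simp [visD, visX, hA, hA1, Set.indicator]

lemma visX_one_step {Ω : Type*} (T : Ω → Ω) (U V : Set Ω) (a : ℕ) (ha : 1 ≤ a) (ω : Ω) :
    visX T U V (fun _ => 1) (a + 1) ω = visX T U V (fun _ => 1) a ω -
      (T^[a] ⁻¹' V).indicator (visX T U V (fun _ => 1) a) ω := by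
  have hs := visA_succ T V a ha ω
  by_cases hA : ω ∈ visA T V a <;> by_cases hV : T^[a] ω ∈ V <;>
    simp [visX, Set.indicator, hs, hA, hV]

lemma not_mem_piRet {Ω : Type*} (T : Ω → Ω) (n : ℕ) (U : Set Ω) (j : ℕ) (hj : 1 ≤ j)
    (h : j < piRet T n U) : U ∩ T^[j] ⁻¹' U = ∅ := by
  unfold piRet at h
  have hne : {k | 1 ≤ k ∧ k ≤ n ∧ (U ∩ T^[k] ⁻¹' U).Nonempty}.Nonempty :=
    Nat.nonempty_of_pos_sInf (by omega)
  have h1 := (Nat.sInf_mem hne).2.1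
  have h2 := Nat.notMem_of_lt_sInf h
  by_contra h3
  exact h2 ⟨hj, h.le.trans h1, Set.nonempty_iff_ne_empty.2 h3⟩

lemma not_mem_piJoint {Ω : Type*} (T : Ω → Ω) (n m : ℕ) (U V : Set Ω) (j : ℕ)
    (h : j < piJoint T n m U V) : U ∩ T^[j] ⁻¹' V = ∅ ∧ V ∩ T^[j] ⁻¹' U = ∅ := by
  unfold piJoint at h
  have hne : {k | k ≤ min n m ∧ ((U ∩ T^[k] ⁻¹' V).Nonempty ∨
      (V ∩ T^[k] ⁻¹' U).Nonempty)}.Nonempty :=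
    Nat.nonempty_of_pos_sInf (by omega)
  have h1 := (Nat.sInf_mem hne).1
  have h2 := Nat.notMem_of_lt_sInf h
  constructor
  · by_contra h3
    exact h2 ⟨h.le.trans h1, Or.inl (Set.nonempty_iff_ne_empty.2 h3)⟩
  · by_contra h3
    exact h2 ⟨h.le.trans h1, Or.inr (Set.nonempty_iff_ne_empty.2 h3)⟩

/-- Main estimate for a single set `G`. -/
lemma main_est (hinv : MeasurePreserving (shift 𝓐) P P) {U V : Set (ℕ → 𝓐)} {L : ℕ}
    (hU : MeasurableSet[coordAlg 𝓐 (Set.Iio L)] U) (hV : MeasurableSet[coordAlg 𝓐 (Set.Iio L)] V)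
    (hUV : U ∩ V = ∅) (R : ℕ) (cU cV : ℝ) (hcU0 : 0 ≤ cU) (hcV0 : 0 ≤ cV)
    (hcU : ∀ j, 1 ≤ j → P.real ((U ∪ V) ∩ (shift 𝓐)^[j] ⁻¹' U) ≤ cU)
    (hcV : ∀ j, 1 ≤ j → P.real ((U ∪ V) ∩ (shift 𝓐)^[j] ⁻¹' V) ≤ cV)
    (G : Set ℕ) (K : ℕ) :
    |P.real (numVisits (shift 𝓐) U V ⁻¹' G) -
        geoG (P.real V / (P.real V + P.real U)) G 0| ≤
      P.real U + (1 - P.real V) ^ K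
        + K * ((2 * R * cU + 2 * R * P.real (U ∪ V) * P.real U + phiMixZ 𝓐 P ((R : ℤ) - L))
          + 2 * (2 * R * cV + 2 * R * P.real (U ∪ V) * P.real V
            + phiMixZ 𝓐 P ((R : ℤ) - L))) := by
  have hU' : MeasurableSet U := coordAlg_le _ _ hU
  have hV' : MeasurableSet V := coordAlg_le _ _ hV
  have hT := hinv.measurable
  have hpU : 0 ≤ P.real U := measureReal_nonneg
  have hpV : 0 ≤ P.real V := measureReal_nonneg
  have hpV1 : P.real V ≤ 1 := measureReal_le_one
  set q := P.real V / (P.real V + P.real U) with hq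
  have hq0 : 0 ≤ q := by positivity
  have hq1 : q ≤ 1 := div_le_one_of_le₀ (by linarith) (by linarith)
  set g := geoG q G with hg
  have hgb : ∀ s, 0 ≤ g s ∧ g s ≤ 1 := fun s => geoG_bd hq0 hq1 G s
  set fU : ℕ → ℝ := fun s => g (s + 1) - g s with hfU
  set fV : ℕ → ℝ := fun s => G.indicator (fun _ => (1 : ℝ)) s - g s with hfV
  have hfU1 : ∀ s, |fU s| ≤ 1 := by
    intro s
    have h1 := hgb s
    have h2 := hgb (s + 1)
    rw [abs_le]
    constructor <;> simp only [hfU] <;> linarith [h1.1, h1.2, h2.1, h2.2]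
  have hfV1 : ∀ s, |fV s| ≤ 1 := by
    intro s
    have h1 := hgb s
    have h2 := ind_bd G s
    rw [abs_le]
    constructor <;> simp only [hfV] <;> linarith [h1.1, h1.2, h2.1, h2.2]
  have hbal : ∀ s, P.real U * fU s + P.real V * fV s = 0 := by
    intro s
    have hrec := geoG_rec hq0 hq1 G s
    by_cases hp : P.real V + P.real U = 0
    · have h1 : P.real U = 0 := by linarith
      have h2 : P.real V = 0 := by linarith
      simp [h1, h2]
    · have h2 : P.real V = q * (P.real V + P.real U) := by rw [hq]; field_simp
      have h1 : P.real U = (1 - q) * (P.real V + P.real U) := by linarith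
      have h3 : P.real U * fU s + P.real V * fV s =
          (P.real V + P.real U) * ((1 - q) * fU s + q * fV s) := by
        calc _ = ((1 - q) * (P.real V + P.real U)) * fU s +
              (q * (P.real V + P.real U)) * fV s := by rw [← h1, ← h2]
          _ = _ := by ring
      rw [h3]
      have : (1 - q) * fU s + q * fV s = 0 := by
        simp only [hfU, hfV]
        change g s = _ + (1 - q) * g (s + 1) at hrec
        linarith
      rw [this, mul_zero]
  have hi : ∀ (f : ℕ → ℝ), (∀ s, |f s| ≤ 1) → ∀ k : ℕ,
      Integrable (visX (shift 𝓐) U V f k) P := by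
    intro f hf k
    refine Integrable.of_bound (gen_meas_X hT hU' hV' f k).aestronglyMeasurable 1 ?_
    exact Eventually.of_forall fun ω => visX_abs _ U V f hf k ω
  have hAm : ∀ a, MeasurableSet (visA (shift 𝓐) V a) := fun a =>
    gen_meas_A _ V a fun i _ => hT.iterate i hV'
  have hNm : Measurable (numVisits (shift 𝓐) U V) := numVisits_meas hT hU' hV'
  have hGm : Measurable (fun ω => G.indicator (fun _ => (1 : ℝ)) (numVisits (shift 𝓐) U V ω)) :=
    (measurable_of_countable (G.indicator fun _ => (1 : ℝ))).comp hNm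
  have hGi : Integrable (fun ω => G.indicator (fun _ => (1 : ℝ)) (numVisits (shift 𝓐) U V ω)) P := by
    refine Integrable.of_bound hGm.aestronglyMeasurable 1 (Eventually.of_forall fun ω => ?_)
    have := ind_bd G (numVisits (shift 𝓐) U V ω)
    rw [Real.norm_eq_abs, abs_of_nonneg this.1]
    exact this.2
  have hg1 : ∀ s, |g s| ≤ 1 := fun s => by
    rw [abs_of_nonneg (hgb s).1]
    exact (hgb s).2
  have hDi : ∀ a, Integrable (visD (shift 𝓐) U V g G a) P := fun a =>
    (hi g hg1 a).add (hGi.indicator (hAm a).compl)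
  have h11 : ∀ s : ℕ, |(fun _ : ℕ => (1 : ℝ)) s| ≤ 1 := fun s => by simp
  set φ := phiMixZ 𝓐 P ((R : ℤ) - L) with hφ
  set CU := 2 * R * cU + 2 * R * P.real (U ∪ V) * P.real U + φ with hCU
  set CV := 2 * R * cV + 2 * R * P.real (U ∪ V) * P.real V + φ with hCV
  have hφ0 : 0 ≤ φ := phiMixZ_nonneg P _
  have hCV0 : 0 ≤ CV := by positivity
  -- one step
  have hstep : ∀ a, 1 ≤ a → |∫ ω, visD (shift 𝓐) U V g G (a + 1) ω ∂P
      - ∫ ω, visD (shift 𝓐) U V g G a ω ∂P| ≤ CU + CV := by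
    intro a ha
    have e : ∫ ω, visD (shift 𝓐) U V g G (a + 1) ω ∂P - ∫ ω, visD (shift 𝓐) U V g G a ω ∂P =
        ∫ ω in (shift 𝓐)^[a] ⁻¹' U, visX (shift 𝓐) U V fU a ω ∂P +
        ∫ ω in (shift 𝓐)^[a] ⁻¹' V, visX (shift 𝓐) U V fV a ω ∂P := by
      rw [← integral_sub (hDi _) (hDi _), ← integral_indicator (hT.iterate a hU'),
        ← integral_indicator (hT.iterate a hV'),
        ← integral_add ((hi fU hfU1 a).indicator (hT.iterate a hU'))
          ((hi fV hfV1 a).indicator (hT.iterate a hV'))]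
      refine integral_congr_ae (Eventually.of_forall fun ω => ?_)
      exact visD_step (shift 𝓐) U V hUV g G a ha ω
    have e2 : P.real U * ∫ ω, visX (shift 𝓐) U V fU a ω ∂P +
        P.real V * ∫ ω, visX (shift 𝓐) U V fV a ω ∂P = 0 := by
      rw [← integral_const_mul, ← integral_const_mul,
        ← integral_add ((hi fU hfU1 a).const_mul _) ((hi fV hfV1 a).const_mul _)]
      refine integral_eq_zero_of_ae (Eventually.of_forall fun ω => ?_)
      simp only [visX, Pi.zero_apply]
      by_cases h : ω ∈ visA (shift 𝓐) V a
      · rw [Set.indicator_of_mem h, Set.indicator_of_mem h]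
        exact hbal _
      · rw [Set.indicator_of_notMem h, Set.indicator_of_notMem h]
        simp
    have k1 := key P hinv hU hV hU' fU hfU1 R a cU hcU0 hcU
    have k2 := key P hinv hU hV hV' fV hfV1 R a cV hcV0 hcV
    rw [e]
    rw [abs_le] at *
    constructor <;> linarith [k1.1, k1.2, k2.1, k2.2]
  have hsteps : ∀ k : ℕ, |∫ ω, visD (shift 𝓐) U V g G (k + 1) ω ∂P
      - ∫ ω, visD (shift 𝓐) U V g G 1 ω ∂P| ≤ k * (CU + CV) := by
    intro k
    induction k with
    | zero => simp
    | succ k ih =>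
      have h := hstep (k + 1) (by omega)
      push_cast
      rw [abs_le] at *
      constructor <;> linarith [h.1, h.2, ih.1, ih.2]
  -- initial step
  have hinit : |∫ ω, visD (shift 𝓐) U V g G 1 ω ∂P - g 0| ≤ P.real U := by
    have e : ∫ ω, visD (shift 𝓐) U V g G 1 ω ∂P - g 0 =
        P.real U * (g 1 - g 0) := by
      have h1 : ∀ ω, visD (shift 𝓐) U V g G 1 ω =
          g 0 + U.indicator (fun _ => g 1 - g 0) ω := by
        intro ω
        have hA : ω ∈ visA (shift 𝓐) V 1 := fun i h1 h2 => by omega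
        simp only [visD, visX]
        rw [Set.indicator_of_mem hA, Set.indicator_of_notMem
          (show ω ∉ (visA (shift 𝓐) V 1)ᶜ from not_not.2 hA)]
        by_cases h : ω ∈ U <;> simp [visS, h]
      simp only [h1]
      rw [integral_add (integrable_const _) ((integrable_const _).indicator hU'),
        integral_indicator_const _ hU']
      simp
    rw [e, abs_mul, abs_of_nonneg hpU]
    exact mul_le_of_le_one_right hpU (hfU1 0)
  -- tail
  have htail : ∀ k : ℕ, ∫ ω, visX (shift 𝓐) U V (fun _ => 1) (k + 1) ω ∂P ≤
      (1 - P.real V) ^ k + k * CV := by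
    intro k
    induction k with
    | zero =>
      simp only [pow_zero, Nat.cast_zero, zero_mul, add_zero]
      calc _ ≤ ∫ _ω : ℕ → 𝓐, (1 : ℝ) ∂P :=
            integral_mono (hi _ h11 _) (integrable_const _)
              fun ω => (abs_le.1 (visX_abs _ U V _ h11 _ ω)).2
        _ = 1 := by simp
    | succ k ih =>
      have e : ∫ ω, visX (shift 𝓐) U V (fun _ => 1) (k + 1 + 1) ω ∂P =
          ∫ ω, visX (shift 𝓐) U V (fun _ => 1) (k + 1) ω ∂P -
          ∫ ω in (shift 𝓐)^[k + 1] ⁻¹' V, visX (shift 𝓐) U V (fun _ => 1) (k + 1) ω ∂P := by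
        rw [← integral_indicator (hT.iterate (k + 1) hV'),
          ← integral_sub (hi _ h11 _) ((hi _ h11 _).indicator (hT.iterate (k + 1) hV'))]
        refine integral_congr_ae (Eventually.of_forall fun ω => ?_)
        exact visX_one_step (shift 𝓐) U V (k + 1) (by omega) ω
      have k2 := (abs_le.1 (key P hinv hU hV hV' (fun _ => 1) h11 R (k + 1) cV hcV0 hcV)).1
      rw [e]
      have h3 : (1 - P.real V) * ∫ ω, visX (shift 𝓐) U V (fun _ => 1) (k + 1) ω ∂P ≤
          (1 - P.real V) * ((1 - P.real V) ^ k + k * CV) :=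
        mul_le_mul_of_nonneg_left ih (by linarith)
      have h4 : (1 - P.real V) * (k * CV) ≤ k * CV :=
        mul_le_of_le_one_left (by positivity) (by linarith)
      push_cast
      rw [pow_succ]
      linarith
  -- final
  have hfin : |P.real (numVisits (shift 𝓐) U V ⁻¹' G) -
      ∫ ω, visD (shift 𝓐) U V g G (K + 1) ω ∂P| ≤
      ∫ ω, visX (shift 𝓐) U V (fun _ => 1) (K + 1) ω ∂P := by
    have e : P.real (numVisits (shift 𝓐) U V ⁻¹' G) =
        ∫ ω, G.indicator (fun _ => (1 : ℝ)) (numVisits (shift 𝓐) U V ω) ∂P := by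
      have h := integral_indicator_const (μ := P) (1 : ℝ)
        (hNm (MeasurableSet.of_discrete (s := G)))
      rw [smul_eq_mul, mul_one] at h
      rw [← h]
      rfl
    rw [e, ← integral_sub hGi (hDi _)]
    refine (abs_integral_le_integral_abs).trans ?_
    refine integral_mono (hGi.sub (hDi _)).abs (hi _ h11 _) fun ω => ?_
    simp only [visD, visX]
    by_cases h : ω ∈ visA (shift 𝓐) V (K + 1)
    · rw [Set.indicator_of_mem h, Set.indicator_of_mem h, Set.indicator_of_notMem
          (show ω ∉ (visA (shift 𝓐) V (K + 1))ᶜ from not_not.2 h)]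
      have h1 := ind_bd G (numVisits (shift 𝓐) U V ω)
      have h2 := hgb (visS (shift 𝓐) U (K + 1) ω)
      rw [abs_le]
      constructor <;> linarith [h1.1, h1.2, h2.1, h2.2]
    · rw [Set.indicator_of_notMem h, Set.indicator_of_notMem h, Set.indicator_of_mem
          (show ω ∈ (visA (shift 𝓐) V (K + 1))ᶜ from h)]
      simp
  have hs := hsteps K
  have ht := htail K
  rw [abs_le] at *
  constructor <;> linarith [hs.1, hs.2, hinit.1, hinit.2, hfin.1, hfin.2]

end helpers

/-- Theorem 2.1: the quantitative geometric law for numbers of returns to `U`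
until the first hit of `V`, for a `φ`-mixing shift-invariant measure. -/
theorem geometric_law_quantitative
    {𝓐 : Type*} [MeasurableSpace 𝓐] [DiscreteMeasurableSpace 𝓐] [Countable 𝓐] [Nontrivial 𝓐]
    (P : Measure (ℕ → 𝓐)) [IsProbabilityMeasure P]
    (hinv : MeasurePreserving (shift 𝓐) P P)
    (hpos : ∀ a : 𝓐, 0 < P {ω | ω 0 = a})
    (n m M R : ℕ) (hn : 1 ≤ n) (hm : 1 ≤ m) (hM : 1 ≤ M) (hR : 1 ≤ R)
    (U V : Set (ℕ → 𝓐))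
    (hU : MeasurableSet[coordAlg 𝓐 (Set.Iio n)] U) (hUne : U.Nonempty)
    (hV : MeasurableSet[coordAlg 𝓐 (Set.Iio m)] V) (hVne : V.Nonempty)
    (hUV : U ∩ V = ∅)
    (r : ℕ) (hr : r < min n m) :
    dTV (P.map (numVisits (shift 𝓐) U V))
        (geoMeasure ((P V).toReal / ((P V).toReal + (P U).toReal)))
      ≤ 2 * ((1 - (P V).toReal) ^ (M + 1) + (P U).toReal
          + 6 * M * R * ((P U).toReal + (P V).toReal) ^ 2
          + 6 * M * phiMixZ 𝓐 P ((R : ℤ) - max n m)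
          + 8 * M * R * ((P U).toReal + (P V).toReal)
            * ((P ((shift 𝓐)^[r] '' U)).toReal + (P ((shift 𝓐)^[r] '' V)).toReal
              + phiMixZ 𝓐 P ((kappa (shift 𝓐) n m U V : ℤ) + r - max n m))) := by
  set L := max n m with hL
  have hU2 : MeasurableSet[coordAlg 𝓐 (Set.Iio L)] U :=
    coordAlg_mono (Set.Iio_subset_Iio (le_max_left n m)) _ hU
  have hV2 : MeasurableSet[coordAlg 𝓐 (Set.Iio L)] V :=
    coordAlg_mono (Set.Iio_subset_Iio (le_max_right n m)) _ hV
  have hU' : MeasurableSet U := coordAlg_le _ _ hU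
  have hV' : MeasurableSet V := coordAlg_le _ _ hV
  set κ := kappa (shift 𝓐) n m U V with hκ
  have hκJ : ∀ j, j < κ → j < piJoint (shift 𝓐) n m U V := fun j hj =>
    hj.trans_le (min_le_left _ _)
  have hκU : ∀ j, j < κ → j < piRet (shift 𝓐) n U := fun j hj =>
    hj.trans_le ((min_le_right _ _).trans (min_le_left _ _))
  have hκV : ∀ j, j < κ → j < piRet (shift 𝓐) m V := fun j hj =>
    hj.trans_le ((min_le_right _ _).trans (min_le_right _ _))
  simp only [← measureReal_def]
  set u := P.real U with hu
  set v := P.real V with hv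
  set φ := phiMixZ 𝓐 P ((R : ℤ) - L) with hφ
  set ψ := phiMixZ 𝓐 P ((κ : ℤ) + r - L) with hψ
  set tU := P.real ((shift 𝓐)^[r] '' U) with htU
  set tV := P.real ((shift 𝓐)^[r] '' V) with htV
  have hφ0 : 0 ≤ φ := phiMixZ_nonneg P _
  have hψ0 : 0 ≤ ψ := phiMixZ_nonneg P _
  have hu0 : 0 ≤ u := measureReal_nonneg
  have hv0 : 0 ≤ v := measureReal_nonneg
  have hv1 : v ≤ 1 := measureReal_le_one
  have htU0 : 0 ≤ tU := measureReal_nonneg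
  have htV0 : 0 ≤ tV := measureReal_nonneg
  have hun : P.real (U ∪ V) = u + v :=
    measureReal_union (Set.disjoint_iff_inter_eq_empty.2 hUV) hV'
  have hcU : ∀ j, 1 ≤ j → P.real ((U ∪ V) ∩ (shift 𝓐)^[j] ⁻¹' U) ≤ (u + v) * (tU + ψ) := by
    intro j hj
    rw [Set.union_inter_distrib_right]
    refine (measureReal_union_le _ _).trans ?_
    have h1 := pair_bound P hinv (r := r) (κ := κ) hU2 hU' le_rfl
      (fun j h1 h2 => not_mem_piRet _ _ _ j h1 (hκU j h2)) j hj
    have h2 := pair_bound P hinv (r := r) (κ := κ) hV2 hU' le_rfl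
      (fun j h1 h2 => (not_mem_piJoint _ _ _ _ _ j (hκJ j h2)).2) j hj
    rw [add_mul]
    exact add_le_add h1 h2
  have hcV : ∀ j, 1 ≤ j → P.real ((U ∪ V) ∩ (shift 𝓐)^[j] ⁻¹' V) ≤ (u + v) * (tV + ψ) := by
    intro j hj
    rw [Set.union_inter_distrib_right]
    refine (measureReal_union_le _ _).trans ?_
    have h1 := pair_bound P hinv (r := r) (κ := κ) hU2 hV' le_rfl
      (fun j h1 h2 => (not_mem_piJoint _ _ _ _ _ j (hκJ j h2)).1) j hj
    have h2 := pair_bound P hinv (r := r) (κ := κ) hV2 hV' le_rfl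
      (fun j h1 h2 => not_mem_piRet _ _ _ j h1 (hκV j h2)) j hj
    rw [add_mul]
    exact add_le_add h1 h2
  have hpw : 0 ≤ (1 - v) ^ (M + 1) := pow_nonneg (by linarith) _
  unfold dTV
  refine Real.sSup_le ?_ (by positivity)
  rintro x ⟨G, hG, rfl⟩
  have hNm : Measurable (numVisits (shift 𝓐) U V) := numVisits_meas hinv.measurable hU' hV'
  rw [Measure.map_apply hNm hG, geoG_zero (by positivity)
    (div_le_one_of_le₀ (by linarith) (by linarith))]
  have hmain := main_est P hinv hU2 hV2 hUV R _ _ (by positivity) (by positivity) hcU hcV G (M + 1)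
  rw [hun] at hmain
  refine hmain.trans ?_
  have hM' : (1 : ℝ) ≤ M := by exact_mod_cast hM
  push_cast
  have hR0 : (0 : ℝ) ≤ R := Nat.cast_nonneg R
  set E := (2 * R * ((u + v) * (tU + ψ)) + 2 * R * (u + v) * u + φ) +
    2 * (2 * R * ((u + v) * (tV + ψ)) + 2 * R * (u + v) * v + φ) with hE
  have hE0 : 0 ≤ E := by positivity
  have h1 : ((M : ℝ) + 1) * E ≤ (2 * M) * E := mul_le_mul_of_nonneg_right (by linarith) hE0
  have hle : E ≤ 6 * R * (u + v) ^ 2 + 6 * φ + 8 * R * (u + v) * (tU + tV + ψ) := by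
    have a1 : 0 ≤ R * (u + v) * tU := by positivity
    have a2 : 0 ≤ R * (u + v) * tV := by positivity
    have a3 : 0 ≤ R * (u + v) * ψ := by positivity
    have a4 : 0 ≤ R * (u + v) * u := by positivity
    have a5 : 0 ≤ R * (u + v) * v := by positivity
    rw [hE]
    linarith
  have h2 : (2 * (M : ℝ)) * E ≤ (2 * M) *
      (6 * R * (u + v) ^ 2 + 6 * φ + 8 * R * (u + v) * (tU + tV + ψ)) :=
    mul_le_mul_of_nonneg_left hle (by positivity)
  linarith
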